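/- arXiv:1903.02811 — 2 statements merged into one kernel-verified Lean document; each statement's English description precedes it below -/
import Mathlib

section
/- Let ω be a primitive m-th root of unity and let ℤ_m act on ℂ^n via T = ωI, i.e., k·x = ω^k x. Then there exist a map Φ : ℂ^n → ℂ^{2n} and a constant C > 0 such that Φ is ℤ_m-invariant (Φ(ωx) = Φ(x)), Φ separates orbits (Φ(x) = Φ(y) if and only if x = ω^k y for some k), and ‖Φ(x) − Φ(y)‖ ≤ C · min_{0 ≤ k < m} ‖x − ω^k y‖ for all x, y ∈ ℂ^n. -/
/-- The sums of `conj (x i) * x i ^ m * x j` over the pairs `i ≤ j` with `i + j = k`. -/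
noncomputable def antidiagonalInvariant (m n : ℕ) (x : EuclideanSpace ℂ (Fin n)) :
    EuclideanSpace ℂ (Fin (2 * n)) :=
  WithLp.toLp 2 fun k => ∑ p : Fin n × Fin n with p.1 ≤ p.2 ∧ (p.1 + p.2 : ℕ) = k,
    starRingEnd ℂ (x p.1) * x p.1 ^ m * x p.2

/-- The extension of `P` from the unit sphere that is homogeneous of degree one. -/
noncomputable def radialExtension {E F : Type*} [NormedAddCommGroup E] [NormedSpace ℝ E]
    [NormedAddCommGroup F] [NormedSpace ℝ F] (P : E → F) (x : E) : F :=
  ‖x‖ • P (‖x‖⁻¹ • x)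

theorem norm_mul_norm_normalize_sub_le {E : Type*} [NormedAddCommGroup E] [NormedSpace ℝ E]
    (x y : E) : ‖y‖ * ‖‖x‖⁻¹ • x - ‖y‖⁻¹ • y‖ ≤ 2 * ‖x - y‖ := by
  rcases eq_or_ne x 0 with rfl | hx
  · rcases eq_or_ne y 0 with rfl | hy
    · simp
    · have : ‖y‖ ≠ 0 := norm_ne_zero_iff.2 hy
      simp only [smul_zero, zero_sub, norm_neg, norm_smul, norm_inv, norm_norm]
      rw [inv_mul_cancel₀ this]
      linarith [norm_nonneg y]
  rcases eq_or_ne y 0 with rfl | hy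
  · simp
  have hx' : ‖x‖ ≠ 0 := norm_ne_zero_iff.2 hx
  have hy' : ‖y‖ ≠ 0 := norm_ne_zero_iff.2 hy
  have h1 : ‖y‖ • (‖x‖⁻¹ • x - ‖y‖⁻¹ • y) = (x - y) + ((‖y‖ - ‖x‖) * ‖x‖⁻¹) • x := by
    rw [smul_sub, smul_smul, smul_smul, mul_inv_cancel₀ hy', sub_mul, mul_inv_cancel₀ hx']
    module
  have h2 : ‖((‖y‖ - ‖x‖) * ‖x‖⁻¹) • x‖ = |‖y‖ - ‖x‖| := by
    rw [norm_smul, norm_mul, norm_inv, norm_norm, mul_assoc, inv_mul_cancel₀ hx', mul_one,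
      Real.norm_eq_abs]
  calc ‖y‖ * ‖‖x‖⁻¹ • x - ‖y‖⁻¹ • y‖ = ‖‖y‖ • (‖x‖⁻¹ • x - ‖y‖⁻¹ • y)‖ := by
        rw [norm_smul, norm_norm]
    _ ≤ ‖x - y‖ + |‖y‖ - ‖x‖| := by
        rw [h1, ← h2]
        exact norm_add_le _ _
    _ ≤ 2 * ‖x - y‖ := by
        have := abs_norm_sub_norm_le y x
        rw [norm_sub_rev] at this
        linarith

theorem norm_inv_norm_smul_le_one {E : Type*} [NormedAddCommGroup E] [NormedSpace ℝ E] (x : E) :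
    ‖‖x‖⁻¹ • x‖ ≤ 1 := by
  rw [norm_smul, norm_inv, norm_norm]
  exact inv_mul_le_one

theorem norm_radialExtension_sub_le {E F : Type*} [NormedAddCommGroup E] [NormedSpace ℝ E]
    [NormedAddCommGroup F] [NormedSpace ℝ F] {P : E → F} {L : NNReal}
    (hP : LipschitzOnWith L P (Metric.closedBall 0 1)) (h0 : P 0 = 0) (x y : E) :
    ‖radialExtension P x - radialExtension P y‖ ≤ 3 * L * ‖x - y‖ := by
  have hmem (z : E) : ‖z‖⁻¹ • z ∈ Metric.closedBall (0 : E) 1 := by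
    simpa using norm_inv_norm_smul_le_one z
  have hbound : ‖P (‖x‖⁻¹ • x)‖ ≤ L := by
    have := hP.norm_sub_le (hmem x) (Metric.mem_closedBall_self zero_le_one)
    rw [h0, sub_zero, sub_zero] at this
    exact this.trans (mul_le_of_le_one_right L.2 (norm_inv_norm_smul_le_one x))
  have hsplit : radialExtension P x - radialExtension P y =
      (‖x‖ - ‖y‖) • P (‖x‖⁻¹ • x) + ‖y‖ • (P (‖x‖⁻¹ • x) - P (‖y‖⁻¹ • y)) := by
    simp only [radialExtension]
    module
  have h1 : |‖x‖ - ‖y‖| * ‖P (‖x‖⁻¹ • x)‖ ≤ ‖x - y‖ * L :=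
    mul_le_mul (abs_norm_sub_norm_le x y) hbound (norm_nonneg _) (norm_nonneg _)
  have h2 : ‖y‖ * ‖P (‖x‖⁻¹ • x) - P (‖y‖⁻¹ • y)‖ ≤ L * (2 * ‖x - y‖) :=
    calc _ ≤ ‖y‖ * (L * ‖‖x‖⁻¹ • x - ‖y‖⁻¹ • y‖) := by
          gcongr
          exact hP.norm_sub_le (hmem x) (hmem y)
      _ = L * (‖y‖ * ‖‖x‖⁻¹ • x - ‖y‖⁻¹ • y‖) := by ring
      _ ≤ _ := by
          exact mul_le_mul_of_nonneg_left (norm_mul_norm_normalize_sub_le x y) L.2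
  rw [hsplit]
  refine (norm_add_le _ _).trans ?_
  rw [norm_smul, norm_smul, norm_norm, Real.norm_eq_abs]
  linarith

theorem contDiff_antidiagonalInvariant (m n : ℕ) : ContDiff ℝ 1 (antidiagonalInvariant m n) := by
  refine (PiLp.contDiff_toLp (𝕜 := ℝ) (p := 2)).comp (contDiff_pi.2 fun k => ?_)
  have hc (i : Fin n) : ContDiff ℝ 1 fun x : EuclideanSpace ℂ (Fin n) => x i :=
    contDiff_piLp_apply (𝕜 := ℝ) 2
  refine ContDiff.sum fun p _ => ?_
  exact ((Complex.conjCLE.contDiff.comp (hc p.1)).mul ((hc p.1).pow m)).mul (hc p.2)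

theorem antidiagonalInvariant_zero (m n : ℕ) : antidiagonalInvariant m n 0 = 0 := by
  ext k
  simp [antidiagonalInvariant]

theorem antidiagonalInvariant_smul_of_pow_eq_one {m n : ℕ} {ω : ℂ} (h1 : ω ^ m = 1)
    (h2 : ‖ω‖ = 1) (x : EuclideanSpace ℂ (Fin n)) :
    antidiagonalInvariant m n (ω • x) = antidiagonalInvariant m n x := by
  have h3 : starRingEnd ℂ ω * ω = 1 := by simp [Complex.conj_mul', h2]
  ext k
  simp only [antidiagonalInvariant, PiLp.smul_apply, smul_eq_mul, map_mul, mul_pow, h1]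
  refine Finset.sum_congr rfl fun p _ => ?_
  linear_combination (starRingEnd ℂ (x p.1) * x p.1 ^ m * x p.2) * h3

theorem antidiagonalInvariant_real_smul {m n : ℕ} (t : ℝ) (x : EuclideanSpace ℂ (Fin n)) :
    antidiagonalInvariant m n (t • x) = t ^ (m + 2) • antidiagonalInvariant m n x := by
  ext k
  simp only [antidiagonalInvariant, PiLp.smul_apply, Complex.real_smul, map_mul, mul_pow,
    Complex.conj_ofReal, Finset.mul_sum, Complex.ofReal_pow]
  refine Finset.sum_congr rfl fun p _ => ?_
  ring

/-- If `x` and `y` vanish below `r` and agree below `j`, equality of the invariants in degree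
`r + j` isolates the term of the pair `(r, j)`. -/
theorem leading_term_eq_of_antidiagonalInvariant_eq {m n : ℕ} {x y : EuclideanSpace ℂ (Fin n)}
    (h : antidiagonalInvariant m n x = antidiagonalInvariant m n y) {r j : Fin n} (hrj : r ≤ j)
    (hr : ∀ i < r, x i = 0 ∧ y i = 0) (hj : ∀ i < j, x i = y i) :
    starRingEnd ℂ (x r) * x r ^ m * x j = starRingEnd ℂ (y r) * y r ^ m * y j := by
  have hk := congrArg (fun z => z ⟨r + j, by omega⟩) h
  simp only [antidiagonalInvariant] at hk
  rw [← sub_eq_zero, ← Finset.sum_sub_distrib, Finset.sum_eq_single (r, j)] at hk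
  · exact sub_eq_zero.1 hk
  · rintro ⟨i, l⟩ hil hne
    simp only [Finset.mem_filter, Finset.mem_univ, true_and] at hil
    rcases lt_trichotomy i r with hi | rfl | hi
    · simp [hr i hi]
    · have hl : l = j := Fin.ext (by simpa using hil.2)
      exact absurd (by rw [hl]) hne
    · have hl : l < j := by
        have := hil.2
        rw [Fin.lt_def] at hi ⊢
        omega
      simp [hj l hl, hj i (hil.1.trans_lt hl)]
  · intro hnot
    simp [hrj] at hnot

theorem pow_eq_pow_of_conj_mul_pow_mul_eq {m : ℕ} {a b : ℂ}
    (h : starRingEnd ℂ a * a ^ m * a = starRingEnd ℂ b * b ^ m * b) :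
    ‖a‖ = ‖b‖ ∧ (a ≠ 0 → a ^ m = b ^ m) := by
  have hn : ‖a‖ = ‖b‖ := by
    have := congrArg norm h
    simp only [norm_mul, norm_pow, RCLike.norm_conj] at this
    refine (pow_left_inj₀ (norm_nonneg a) (norm_nonneg b) (by omega : m + 2 ≠ 0)).1 ?_
    linear_combination this
  refine ⟨hn, fun ha => ?_⟩
  have ha' : (‖a‖ : ℂ) ^ 2 ≠ 0 := by simpa using ha
  refine mul_left_cancel₀ ha' ?_
  have h1 := Complex.conj_mul' a
  have h2 := Complex.conj_mul' b
  rw [← hn] at h2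
  linear_combination h - a ^ m * h1 + b ^ m * h2

theorem exists_eq_smul_of_antidiagonalInvariant_eq {m n : ℕ} (hm : 0 < m) {ω : ℂ}
    (hω : IsPrimitiveRoot ω m) {x y : EuclideanSpace ℂ (Fin n)}
    (h : antidiagonalInvariant m n x = antidiagonalInvariant m n y) :
    ∃ k : ℕ, x = ω ^ k • y := by
  have : NeZero m := ⟨hm.ne'⟩
  by_cases hz : ∃ i, x i ≠ 0 ∨ y i ≠ 0
  · obtain ⟨r, hr, hmin⟩ := wellFounded_lt.has_min {i : Fin n | x i ≠ 0 ∨ y i ≠ 0} hz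
    have hbelow (i : Fin n) (hi : i < r) : x i = 0 ∧ y i = 0 := by
      by_contra hc
      exact hmin i (by simpa [imp_iff_not_or] using hc) hi
    obtain ⟨hnorm, hpow⟩ := pow_eq_pow_of_conj_mul_pow_mul_eq
      (leading_term_eq_of_antidiagonalInvariant_eq h le_rfl hbelow
        fun i hi => (hbelow i hi).1.trans (hbelow i hi).2.symm)
    have hx : x r ≠ 0 := by
      rcases hr with hr | hr
      · exact hr
      · rwa [← norm_ne_zero_iff, hnorm, norm_ne_zero_iff]
    have hy : y r ≠ 0 := by rwa [← norm_ne_zero_iff, ← hnorm, norm_ne_zero_iff]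
    obtain ⟨k, -, hk⟩ := hω.eq_pow_of_pow_eq_one (ξ := x r / y r)
      (by rw [div_pow, hpow hx, div_self (pow_ne_zero m hy)])
    have hroot : (ω ^ k) ^ m = 1 := by rw [← pow_mul, mul_comm, pow_mul, hω.pow_eq_one, one_pow]
    refine ⟨k, ?_⟩
    have hxr : x r = (ω ^ k • y) r := by
      rw [PiLp.smul_apply, hk, smul_eq_mul, div_mul_cancel₀ _ hy]
    have h' : antidiagonalInvariant m n x = antidiagonalInvariant m n (ω ^ k • y) := by
      rw [h, antidiagonalInvariant_smul_of_pow_eq_one hroot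
        (Complex.norm_eq_one_of_pow_eq_one hroot hm.ne')]
    have hbelow' (i : Fin n) (hi : i < r) : x i = 0 ∧ (ω ^ k • y) i = 0 := by
      simp [hbelow i hi]
    ext j
    induction j using WellFoundedLT.induction with
    | ind j ih =>
      rcases lt_or_ge j r with hj | hj
      · rw [(hbelow' j hj).1, (hbelow' j hj).2]
      · have := leading_term_eq_of_antidiagonalInvariant_eq h' hj hbelow' ih
        rw [← hxr] at this
        exact mul_left_cancel₀ (mul_ne_zero (by simpa using hx) (pow_ne_zero m hx)) this
  · push Not at hz
    refine ⟨0, ?_⟩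
    ext i
    simp [hz i]

theorem exists_eq_smul_of_radialExtension_eq {m n : ℕ} (hm : 0 < m) {ω : ℂ}
    (hω : IsPrimitiveRoot ω m) {x y : EuclideanSpace ℂ (Fin n)}
    (h : radialExtension (antidiagonalInvariant m n) x =
      radialExtension (antidiagonalInvariant m n) y) :
    ∃ k : ℕ, x = ω ^ k • y := by
  have hω1 : ‖ω‖ = 1 := hω.norm'_eq_one hm.ne'
  have hvanish (z : EuclideanSpace ℂ (Fin n))
      (hz : radialExtension (antidiagonalInvariant m n) z = 0) : z = 0 := by
    rcases smul_eq_zero.1 hz with hz | hz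
    · exact norm_eq_zero.1 hz
    · obtain ⟨k, hk⟩ := exists_eq_smul_of_antidiagonalInvariant_eq hm hω
        (hz.trans (antidiagonalInvariant_zero m n).symm)
      rw [smul_zero, smul_eq_zero, inv_eq_zero, norm_eq_zero, or_self] at hk
      exact hk
  have hzero : radialExtension (antidiagonalInvariant m n) 0 = 0 := by simp [radialExtension]
  rcases eq_or_ne x 0 with rfl | hx
  · exact ⟨0, by rw [hvanish y (h.symm.trans hzero), smul_zero]⟩
  have hy : y ≠ 0 := by
    rintro rfl
    exact hx (hvanish x (h.trans hzero))
  have hx' : 0 < ‖x‖ := norm_pos_iff.2 hx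
  have hy' : 0 < ‖y‖ := norm_pos_iff.2 hy
  obtain ⟨s, hs, hsd⟩ : ∃ s : ℝ, 0 ≤ s ∧ s ^ (m + 2) = ‖x‖⁻¹ * ‖y‖ :=
    ⟨(‖x‖⁻¹ * ‖y‖) ^ ((m + 2 : ℕ) : ℝ)⁻¹, by positivity,
      Real.rpow_inv_natCast_pow (by positivity) (by omega)⟩
  have hP : antidiagonalInvariant m n (‖x‖⁻¹ • x) =
      antidiagonalInvariant m n (s • ‖y‖⁻¹ • y) := by
    rw [antidiagonalInvariant_real_smul s, hsd, mul_smul]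
    exact (eq_inv_smul_iff₀ hx'.ne').2 h
  obtain ⟨k, hk⟩ := exists_eq_smul_of_antidiagonalInvariant_eq hm hω hP
  have hs1 : s = 1 := by
    have := congrArg norm hk
    simp only [norm_smul, norm_pow, hω1, one_pow, norm_inv, norm_norm, one_mul,
      inv_mul_cancel₀ hx'.ne', inv_mul_cancel₀ hy'.ne', mul_one, Real.norm_of_nonneg hs] at this
    exact this.symm
  have hxy : ‖x‖ = ‖y‖ := by
    rw [hs1, one_pow] at hsd
    field_simp at hsd
    exact hsd
  refine ⟨k, ?_⟩
  rw [hs1, one_smul, hxy, smul_comm] at hk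
  exact smul_right_injective _ (inv_ne_zero hy'.ne') hk

theorem radialExtension_antidiagonalInvariant_smul {m n : ℕ} {ω : ℂ} (h1 : ω ^ m = 1)
    (h2 : ‖ω‖ = 1) (x : EuclideanSpace ℂ (Fin n)) :
    radialExtension (antidiagonalInvariant m n) (ω • x) =
      radialExtension (antidiagonalInvariant m n) x := by
  simp only [radialExtension]
  rw [norm_smul, h2, one_mul, smul_comm, antidiagonalInvariant_smul_of_pow_eq_one h1 h2]


/-- **the homogeneous case `T = ωI`.** Let `ω` be a primitive `m`-th
root of unity and let `ℤ_m` act on `ℂ^n` by scalar multiplication `k • x = ω^k x`.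
Then there are a map `Φ : ℂ^n → ℂ^{2n}` and a constant `C > 0` such that `Φ` is
`ℤ_m`-invariant, separates the orbits, and is `C`-Lipschitz with respect to the
orbit distance `min_{0 ≤ k < m} ‖x - ω^k y‖`. -/
theorem homogeneous_case_invariant_lipschitz_measurements
    (m n : ℕ) (hm : 0 < m) (ω : ℂ) (hω : IsPrimitiveRoot ω m) :
    ∃ Φ : EuclideanSpace ℂ (Fin n) → EuclideanSpace ℂ (Fin (2 * n)),
      ∃ C : ℝ, 0 < C ∧
        (∀ x : EuclideanSpace ℂ (Fin n), Φ (ω • x) = Φ x) ∧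
        (∀ x y : EuclideanSpace ℂ (Fin n), Φ x = Φ y ↔ ∃ k : ℕ, x = ω ^ k • y) ∧
        (∀ x y : EuclideanSpace ℂ (Fin n),
          ‖Φ x - Φ y‖ ≤ C * ⨅ k : Fin m, ‖x - ω ^ (k : ℕ) • y‖) := by
  have hω1 : ‖ω‖ = 1 := hω.norm'_eq_one hm.ne'
  have hroot (k : ℕ) : (ω ^ k) ^ m = 1 := by
    rw [← pow_mul, mul_comm, pow_mul, hω.pow_eq_one, one_pow]
  have hinv (k : ℕ) (x : EuclideanSpace ℂ (Fin n)) :=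
    radialExtension_antidiagonalInvariant_smul (hroot k) (by rw [norm_pow, hω1, one_pow]) x
  obtain ⟨L, hL⟩ := (contDiff_antidiagonalInvariant m n).contDiffOn.exists_lipschitzOnWith
    one_ne_zero (convex_closedBall 0 1) (isCompact_closedBall 0 1)
  refine ⟨radialExtension (antidiagonalInvariant m n), 3 * L + 1, by positivity,
    fun x => by simpa using hinv 1 x,
    fun x y => ⟨exists_eq_smul_of_radialExtension_eq hm hω, ?_⟩, fun x y => ?_⟩
  · rintro ⟨k, rfl⟩
    exact hinv k y
  · have : NeZero m := ⟨hm.ne'⟩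
    obtain ⟨k, hk⟩ := exists_eq_ciInf_of_finite (f := fun k : Fin m => ‖x - ω ^ (k : ℕ) • y‖)
    rw [← hk, ← hinv k y]
    refine (norm_radialExtension_sub_le hL (antidiagonalInvariant_zero m n) _ _).trans ?_
    gcongr
    linarith
end

section
/- Let a finite group G act on ℂ^n through a unitary representation σ : G → U(n), and let F : ℂ^n → ℂ^N be a continuous G-invariant map that has the non-parallel property, separates G-orbits (F(x) = F(y) implies x = g y for some g ∈ G), and satisfies F(z) ≠ 0 for every z with ‖z‖ = 1. Then the inverse of the induced injection on orbit space is continuous: for any x ∈ ℂ^n and any sequence (x_k) in ℂ^n with Φ_F(x_k) → Φ_F(x), one has d_G([x_k],[x]) = min_{g ∈ G} ‖x_k − σ(g)x‖ → 0 as k → ∞. -/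
open scoped Classical

/-- For a map `F : ℂ^n → ℂ^N`, the radially extended map
`Φ_F(x) = ‖x‖ • F(x/‖x‖)` for `x ≠ 0`, `Φ_F(0) = 0`. -/
noncomputable def PhiMap {n N : ℕ}
    (F : EuclideanSpace ℂ (Fin n) → EuclideanSpace ℂ (Fin N))
    (x : EuclideanSpace ℂ (Fin n)) : EuclideanSpace ℂ (Fin N) :=
  if x = 0 then 0 else ‖x‖ • F (‖x‖⁻¹ • x)

theorem PhiMap_eq_smul {n N : ℕ} (F : EuclideanSpace ℂ (Fin n) → EuclideanSpace ℂ (Fin N))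
    (x : EuclideanSpace ℂ (Fin n)) : PhiMap F x = ‖x‖ • F (‖x‖⁻¹ • x) := by
  unfold PhiMap
  split_ifs with h
  · simp [h]
  · rfl

theorem norm_inv_norm_smul {E : Type*} [NormedAddCommGroup E] [NormedSpace ℝ E] {x : E}
    (hx : x ≠ 0) : ‖‖x‖⁻¹ • x‖ = 1 := by
  rw [norm_smul, norm_inv, norm_norm, inv_mul_cancel₀ (norm_ne_zero_iff.mpr hx)]

theorem PhiMap_continuous {n N : ℕ} {F : EuclideanSpace ℂ (Fin n) → EuclideanSpace ℂ (Fin N)}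
    (hF : Continuous F) : Continuous (PhiMap F) := by
  obtain ⟨C, hC⟩ := (isCompact_sphere (0 : EuclideanSpace ℂ (Fin n)) 1).exists_bound_of_continuousOn
    hF.continuousOn
  have hle : ∀ z, ‖PhiMap F z‖ ≤ ‖z‖ * C := fun z => by
    rw [PhiMap_eq_smul, norm_smul, norm_norm]
    rcases eq_or_ne z 0 with rfl | hz
    · simp
    · exact mul_le_mul_of_nonneg_left
        (hC _ (mem_sphere_zero_iff_norm.mpr (norm_inv_norm_smul hz))) (norm_nonneg z)
  rw [continuous_iff_continuousAt]
  intro x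
  rcases eq_or_ne x 0 with rfl | hx
  · have h0 : PhiMap F 0 = 0 := by simp [PhiMap]
    rw [ContinuousAt, h0]
    refine squeeze_zero_norm hle ?_
    have : Continuous fun z : EuclideanSpace ℂ (Fin n) => ‖z‖ * C := by fun_prop
    simpa using this.tendsto 0
  · rw [funext (PhiMap_eq_smul F)]
    exact continuousAt_id.norm.smul (hF.continuousAt.comp
      ((continuousAt_id.norm.inv₀ (norm_ne_zero_iff.mpr hx)).smul continuousAt_id))

theorem exists_pos_mul_norm_le_norm_PhiMap {n N : ℕ}
    {F : EuclideanSpace ℂ (Fin n) → EuclideanSpace ℂ (Fin N)} (hF : Continuous F)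
    (hnz : ∀ z : EuclideanSpace ℂ (Fin n), ‖z‖ = 1 → F z ≠ 0) :
    ∃ c : ℝ, 0 < c ∧ ∀ z, c * ‖z‖ ≤ ‖PhiMap F z‖ := by
  obtain ⟨c, hc, h⟩ := (isCompact_sphere (0 : EuclideanSpace ℂ (Fin n)) 1).exists_forall_le'
    hF.norm.continuousOn
    (a := 0) fun z hz => norm_pos_iff.mpr (hnz z (mem_sphere_zero_iff_norm.mp hz))
  refine ⟨c, hc, fun z => ?_⟩
  rw [PhiMap_eq_smul, norm_smul, norm_norm, mul_comm]
  rcases eq_or_ne z 0 with rfl | hz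
  · simp
  · exact mul_le_mul_of_nonneg_left
      (h _ (mem_sphere_zero_iff_norm.mpr (norm_inv_norm_smul hz))) (norm_nonneg z)

theorem PhiMap_separates_orbits {n N : ℕ} {G : Type*} [Group G]
    (σ : G →* (EuclideanSpace ℂ (Fin n) ≃ₗᵢ[ℂ] EuclideanSpace ℂ (Fin n)))
    {F : EuclideanSpace ℂ (Fin n) → EuclideanSpace ℂ (Fin N)}
    (hinv : ∀ (g : G) (x : EuclideanSpace ℂ (Fin n)), F (σ g x) = F x)
    (hNPP : ∀ (x y : EuclideanSpace ℂ (Fin n)) (lam : ℝ), ‖x‖ = 1 → ‖y‖ = 1 → 0 < lam →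
      F x = (lam : ℂ) • F y → ∃ g : G, x = σ g y)
    (hnz : ∀ z : EuclideanSpace ℂ (Fin n), ‖z‖ = 1 → F z ≠ 0)
    {x y : EuclideanSpace ℂ (Fin n)} (h : PhiMap F y = PhiMap F x) :
    ∃ g : G, y = σ g x := by
  have eq_zero : ∀ z, PhiMap F z = 0 → z = 0 := fun z hz => by
    by_contra hne
    rw [PhiMap_eq_smul, smul_eq_zero, norm_eq_zero] at hz
    exact hz.elim hne (hnz _ (norm_inv_norm_smul hne))
  have h0 : PhiMap F 0 = 0 := by simp [PhiMap]
  rcases eq_or_ne x 0 with rfl | hx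
  · exact ⟨1, by simpa using eq_zero y (h.trans h0)⟩
  have hy : y ≠ 0 := by
    rintro rfl
    exact hx (eq_zero x (h.symm.trans h0))
  have hx' := norm_pos_iff.mpr hx
  have hy' := norm_pos_iff.mpr hy
  rw [PhiMap_eq_smul, PhiMap_eq_smul] at h
  obtain ⟨g, hg⟩ := hNPP (‖y‖⁻¹ • y) (‖x‖⁻¹ • x) (‖y‖⁻¹ * ‖x‖) (norm_inv_norm_smul hy)
    (norm_inv_norm_smul hx) (by positivity) (by
      rw [Complex.coe_smul, mul_smul, ← h, inv_smul_smul₀ hy'.ne'])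
  have hnorm : ‖y‖ = ‖x‖ := by
    rw [hg, hinv] at h
    exact smul_left_injective ℝ (hnz _ (norm_inv_norm_smul hx)) h
  refine ⟨g, ?_⟩
  have hsmul : σ g (‖x‖⁻¹ • x) = ‖x‖⁻¹ • σ g x := by
    rw [← Complex.coe_smul, ← Complex.coe_smul, map_smul]
  rw [hsmul, hnorm] at hg
  exact smul_right_injective _ (inv_ne_zero hx'.ne') hg

/-- Let a finite group `G` act on `ℂ^n` through a unitary
representation `σ`, and let `F : ℂ^n → ℂ^N` be continuous, `G`-invariant, with the
non-parallel property, separating `G`-orbits, and nonvanishing on the unit sphere.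
Then the inverse of the injection induced by `Φ_F` on the orbit space is continuous:
if `Φ_F(x_k) → Φ_F(x)` then `d_G([x_k], [x]) → 0`. -/
theorem PhiMap_inverse_continuous
    {n N : ℕ} {G : Type*} [Group G] [Finite G]
    (σ : G →* (EuclideanSpace ℂ (Fin n) ≃ₗᵢ[ℂ] EuclideanSpace ℂ (Fin n)))
    (F : EuclideanSpace ℂ (Fin n) → EuclideanSpace ℂ (Fin N))
    (hcont : Continuous F)
    (hinv : ∀ (g : G) (x : EuclideanSpace ℂ (Fin n)), F (σ g x) = F x)
    (hNPP : ∀ (x y : EuclideanSpace ℂ (Fin n)) (lam : ℝ), ‖x‖ = 1 → ‖y‖ = 1 → 0 < lam →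
      F x = (lam : ℂ) • F y → ∃ g : G, x = σ g y)
    (hsep : ∀ x y : EuclideanSpace ℂ (Fin n), F x = F y → ∃ g : G, x = σ g y)
    (hnz : ∀ z : EuclideanSpace ℂ (Fin n), ‖z‖ = 1 → F z ≠ 0) :
    ∀ (x : EuclideanSpace ℂ (Fin n)) (xs : ℕ → EuclideanSpace ℂ (Fin n)),
      Filter.Tendsto (fun k => PhiMap F (xs k)) Filter.atTop (nhds (PhiMap F x)) →
      Filter.Tendsto (fun k => ⨅ g : G, ‖xs k - σ g x‖) Filter.atTop (nhds 0) := by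
  intro x xs hxs
  obtain ⟨c, hc, hle⟩ := exists_pos_mul_norm_le_norm_PhiMap hcont hnz
  refine Filter.tendsto_of_subseq_tendsto fun ns hns => ?_
  obtain ⟨R, hR⟩ := (Metric.isBounded_range_of_tendsto _ hxs).exists_norm_le
  have hmem : ∀ k, xs (ns k) ∈ Metric.closedBall (0 : EuclideanSpace ℂ (Fin n)) (R / c) := by
    intro k
    rw [mem_closedBall_zero_iff, le_div_iff₀ hc, mul_comm]
    exact (hle _).trans (hR _ ⟨ns k, rfl⟩)
  obtain ⟨y, -, φ, hφ, hy⟩ := (isCompact_closedBall _ _).tendsto_subseq hmem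
  have hΦ : PhiMap F y = PhiMap F x :=
    tendsto_nhds_unique (((PhiMap_continuous hcont).tendsto y).comp hy)
      (hxs.comp (hns.comp hφ.tendsto_atTop))
  obtain ⟨g, rfl⟩ := PhiMap_separates_orbits σ hinv hNPP hnz hΦ
  refine ⟨φ, squeeze_zero (fun k => Real.iInf_nonneg fun _ => norm_nonneg _)
    (fun k => ciInf_le (Set.finite_range _).bddBelow g) ?_⟩
  exact tendsto_iff_norm_sub_tendsto_zero.mp hy
end
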